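/- Let {P_f1, ..., P_fh, C} be an h-fragmentation of a pattern graph P, and let B be a ball in a data graph G with P ≺ B. Then P_fi ≺ B for every i ∈ [1, h], and, writing M for the maximum match relation of P in B and M_i for the maximum match relation of P_fi in B, it holds that M ⊆ ∪_{i=1}^{h} M_i. -/

import Mathlib

/-- A simulation of the pattern `P` in a subgraph `H` of the data graph `G`. -/
def IsSimulationSub {VP V L : Type} (P : SimpleGraph VP) (lP : VP → L)
    (G : SimpleGraph V) (H : G.Subgraph) (l : V → Set L) (M : VP → V → Prop) : Prop :=
  (∀ u v, M u v → v ∈ H.verts ∧ lP u ∈ l v) ∧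
  (∀ u, ∃ v, M u v) ∧
  (∀ u v, M u v → ∀ u', P.Adj u u' → ∃ v', H.Adj v v' ∧ M u' v')

/-- A simulation of the fragment of `P` induced on the node set `Vf` (its edges
are exactly the edges of `P` with both endpoints in `Vf`; nodes keep their
labels) in a subgraph `B` of the data graph `G`. -/
def IsFragSim {VP V L : Type} (P : SimpleGraph VP) (Vf : Set VP) (lP : VP → L)
    (G : SimpleGraph V) (B : G.Subgraph) (l : V → Set L) (M : VP → V → Prop) : Prop :=
  (∀ u v, M u v → u ∈ Vf ∧ v ∈ B.verts ∧ lP u ∈ l v) ∧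
  (∀ u ∈ Vf, ∃ v, M u v) ∧
  (∀ u v, M u v → ∀ u', (u ∈ Vf ∧ u' ∈ Vf ∧ P.Adj u u') →
    ∃ v', B.Adj v v' ∧ M u' v')

/-- The set of nodes at hop-distance at most `t` from `v` in `G`. -/
def ballVerts {V : Type} (G : SimpleGraph V) (v : V) (t : ℕ) : Set V :=
  {w | ∃ p : G.Walk v w, p.length ≤ t}

/-- The ball `B[v, t]` as an induced subgraph of `G`. -/
def ball {V : Type} (G : SimpleGraph V) (v : V) (t : ℕ) : G.Subgraph :=
  (⊤ : G.Subgraph).induce (ballVerts G v t)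

/-- Restricting a simulation of `P` to the nodes in `Vf` gives a simulation of the
fragment of `P` induced on `Vf`. -/
theorem IsSimulationSub.isFragSim_restrict {VP V L : Type} {P : SimpleGraph VP} {lP : VP → L}
    {G : SimpleGraph V} {H : G.Subgraph} {l : V → Set L} {M : VP → V → Prop}
    (hM : IsSimulationSub P lP G H l M) (Vf : Set VP) :
    IsFragSim P Vf lP G H l (fun u v => u ∈ Vf ∧ M u v) := by
  obtain ⟨hlabel, htotal, hadj⟩ := hM
  refine ⟨fun u v huv => ⟨huv.1, hlabel u v huv.2⟩, fun u hu => ?_, ?_⟩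
  · obtain ⟨v, hv⟩ := htotal u
    exact ⟨v, hu, hv⟩
  · rintro u v ⟨-, huv⟩ u' ⟨-, hu', huu'⟩
    obtain ⟨v', hvv', hv'⟩ := hadj u v huv u' huu'
    exact ⟨v', hvv', hu', hv'⟩

/-- for an `h`-fragmentation of `P` (the node sets `Vf i` partition
`V_P`, each fragment is the subpattern of `P` induced on `Vf i`, and the cut
consists of the remaining edges) and a ball `B` in `G` with `P ≺ B`: every
fragment matches `B` via graph simulation, and the maximum match relation `M`
of `P` in `B` is contained in the union of the maximum match relations `Mi i`
of the fragments in `B`. -/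
theorem fragmentation_max_match_subset {VP V L : Type} [Fintype VP] [Fintype V]
    (P : SimpleGraph VP) (lP : VP → L) (G : SimpleGraph V) (l : V → Set L)
    (h : ℕ) (Vf : Fin h → Set VP)
    (hcover : ∀ u, ∃ i, u ∈ Vf i)
    (hdisj : ∀ i j, i ≠ j → Disjoint (Vf i) (Vf j))
    (v : V) (t : ℕ)
    (hPB : ∃ M0, IsSimulationSub P lP G (ball G v t) l M0)
    (M : VP → V → Prop)
    (hM : IsSimulationSub P lP G (ball G v t) l M ∧
      ∀ N, IsSimulationSub P lP G (ball G v t) l N → ∀ u w, N u w → M u w)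
    (Mi : Fin h → (VP → V → Prop))
    (hMi : ∀ i, IsFragSim P (Vf i) lP G (ball G v t) l (Mi i) ∧
      ∀ N, IsFragSim P (Vf i) lP G (ball G v t) l N → ∀ u w, N u w → Mi i u w) :
    (∀ i, ∃ N, IsFragSim P (Vf i) lP G (ball G v t) l N) ∧
    (∀ u w, M u w → ∃ i, Mi i u w) := by
  refine ⟨fun i => ⟨_, hM.1.isFragSim_restrict (Vf i)⟩, fun u w huw => ?_⟩
  obtain ⟨i, hi⟩ := hcover u
  exact ⟨i, (hMi i).2 _ (hM.1.isFragSim_restrict (Vf i)) u w ⟨hi, huw⟩⟩
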